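/- arXiv:1809.07186 — 7 statements merged into one kernel-verified Lean document; each statement's English description precedes it below -/
import Mathlib

section
/- Let k ≥ 1 and f, r be natural numbers, and let M be a complex matrix indexed by Fin f ⊕ (ZMod k × Fin r) such that: M (inr (i,a)) (inr (j,b)) = Cblk (j−i) a b for a family Cblk : ZMod k → Matrix (Fin r) (Fin r) ℂ; M (inl x) (inr (i,a)) = H x a for a matrix H : Matrix (Fin f) (Fin r) ℂ (independent of i); and M (inr (i,a)) (inl x) = L a x for a matrix L : Matrix (Fin r) (Fin f) ℂ (independent of i). Let F be the top-left block F x y = M (inl x) (inl y), let ω = exp(2πi/k), and for j ∈ ZMod k set B_j = Σ_{m ∈ ZMod k} ω^{jm} • Cblk m (exponent jm computed in ZMod k). Let M_φ be the block matrix [[F, k•H],[L, B_0]] indexed by Fin f ⊕ Fin r. Then the multiset of roots (with multiplicity) of the characteristic polynomial of M equals the multiset of roots of the characteristic polynomial of M_φ plus the sum over all nonzero j ∈ ZMod k of the multisets of roots of the characteristic polynomials of the B_j. -/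
open Matrix Polynomial

/-- Block diagonal matrices have the product of the block characteristic polynomials as their
characteristic polynomial. -/
theorem Matrix.charpoly_blockDiagonal {o n R : Type*} [Fintype o] [DecidableEq o] [Fintype n]
    [DecidableEq n] [CommRing R] (A : o → Matrix n n R) :
    (blockDiagonal A).charpoly = ∏ i, (A i).charpoly := by
  have h : (blockDiagonal A).charmatrix = blockDiagonal fun i => (A i).charmatrix := by
    ext ⟨a, i⟩ ⟨b, j⟩
    by_cases hij : i = j
    · subst hij
      simp [charmatrix_apply, blockDiagonal_apply, diagonal_apply]
    · simp [blockDiagonal_apply, hij]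
  rw [charpoly, h, det_blockDiagonal]
  rfl

/-- Matrices intertwined by an invertible matrix have the same characteristic polynomial. -/
theorem Matrix.charpoly_eq_of_mul_eq_mul {n R : Type*} [Fintype n] [DecidableEq n] [CommRing R]
    {A D U V : Matrix n n R} (hUV : U * V = 1) (h : A * U = U * D) : A.charpoly = D.charpoly := by
  have hVU : V * U = 1 := mul_eq_one_comm.mp hUV
  have hA : A = U * D * V := by rw [← h, Matrix.mul_assoc, hUV, Matrix.mul_one]
  rw [hA, charpoly_mul_comm, ← Matrix.mul_assoc, hVU, Matrix.one_mul]

/-- A matrix that only couples the extra indices to the zeroth diagonal block has a factored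
characteristic polynomial. -/
theorem Matrix.charpoly_fromBlocks_single_coupling {m n o R : Type*} [Fintype m] [DecidableEq m]
    [Fintype n] [DecidableEq n] [Fintype o] [DecidableEq o] [CommRing R] (i₀ : o)
    (F : Matrix m m R) (H : Matrix m n R) (L : Matrix n m R) (B : o → Matrix n n R) :
    (fromBlocks F (of fun x (p : o × n) => if p.1 = i₀ then H x p.2 else 0)
        (of fun (p : o × n) x => if p.1 = i₀ then L p.2 x else 0)
        (of fun p q : o × n => if p.1 = q.1 then B p.1 p.2 q.2 else 0)).charpoly =
      (fromBlocks F H L (B i₀)).charpoly * ∏ i ∈ Finset.univ \ {i₀}, (B i).charpoly := by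
  let g : (m ⊕ n) ⊕ (n × {i : o // i ≠ i₀}) → m ⊕ (o × n) :=
    Sum.elim (Sum.elim Sum.inl fun a => Sum.inr (i₀, a)) fun p => Sum.inr (p.2.1, p.1)
  have hg : Function.Bijective g := by
    constructor
    · rintro ((x | a) | ⟨a, i, hi⟩) ((y | b) | ⟨b, j, hj⟩) h <;> simp [g] at h ⊢ <;> grind
    · rintro (x | ⟨i, a⟩)
      · exact ⟨Sum.inl (Sum.inl x), rfl⟩
      · by_cases hi : i = i₀
        · exact ⟨Sum.inl (Sum.inr a), by simp [g, hi]⟩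
        · exact ⟨Sum.inr (a, ⟨i, hi⟩), rfl⟩
  rw [← charpoly_reindex (Equiv.ofBijective g hg).symm]
  have h : reindex (Equiv.ofBijective g hg).symm (Equiv.ofBijective g hg).symm
      (fromBlocks F (of fun x (p : o × n) => if p.1 = i₀ then H x p.2 else 0)
        (of fun (p : o × n) x => if p.1 = i₀ then L p.2 x else 0)
        (of fun p q : o × n => if p.1 = q.1 then B p.1 p.2 q.2 else 0)) =
      fromBlocks (fromBlocks F H L (B i₀)) 0 0
        (blockDiagonal fun i : {i : o // i ≠ i₀} => B i) := by
    ext ((x | a) | ⟨a, i, hi⟩) ((y | b) | ⟨b, j, hj⟩) <;>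
      simp [g, blockDiagonal_apply] <;> grind
  rw [h, charpoly_fromBlocks_zero₁₂, charpoly_blockDiagonal]
  congr 1
  exact (Finset.prod_subtype (Finset.univ \ {i₀}) (by simp) fun i => (B i).charpoly).symm

theorem ZMod.sum_stdAddChar_mul (k : ℕ) [NeZero k] (j : ZMod k) :
    ∑ i : ZMod k, stdAddChar (i * j) = if j = 0 then (k : ℂ) else 0 := by
  simpa [ZMod.card] using AddChar.sum_mulShift j (isPrimitive_stdAddChar k)

theorem ZMod.exp_pow_val_eq_stdAddChar (k : ℕ) [NeZero k] (j : ZMod k) :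
    Complex.exp (2 * (Real.pi : ℂ) * Complex.I / (k : ℂ)) ^ j.val = stdAddChar j := by
  rw [stdAddChar_apply, toCircle_apply, ← Complex.exp_nat_mul]
  congr 1
  ring

/-- The matrix of the discrete Fourier transform on blocks, extended by the identity. -/
noncomputable def blockFourier (k : ℕ) [NeZero k] (m n : Type*) [DecidableEq m] [DecidableEq n] :
    Matrix (m ⊕ (ZMod k × n)) (m ⊕ (ZMod k × n)) ℂ :=
  fromBlocks 1 0 0 (of fun p q => if p.2 = q.2 then ZMod.stdAddChar (p.1 * q.1) else 0)

theorem exists_blockFourier_mul_eq_one (k : ℕ) [NeZero k] (m n : Type*) [Fintype m]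
    [DecidableEq m] [Fintype n] [DecidableEq n] : ∃ V, blockFourier k m n * V = 1 := by
  refine ⟨fromBlocks 1 0 0
    (of fun p q => if p.2 = q.2 then (k : ℂ)⁻¹ * ZMod.stdAddChar (-(p.1 * q.1)) else 0), ?_⟩
  have hk : (k : ℂ) ≠ 0 := NeZero.ne _
  rw [blockFourier, fromBlocks_multiply]
  simp only [Matrix.mul_zero, Matrix.zero_mul, Matrix.mul_one, add_zero, zero_add]
  rw [← fromBlocks_one]
  congr 1
  ext ⟨i, a⟩ ⟨j, b⟩
  have hsum := ZMod.sum_stdAddChar_mul k (i - j)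
  simp only [mul_apply, of_apply, Fintype.sum_prod_type, one_apply, Prod.mk.injEq]
  by_cases hab : a = b
  · subst hab
    have h (l : ZMod k) : (ZMod.stdAddChar (i * l) : ℂ) * ((k : ℂ)⁻¹ *
        ZMod.stdAddChar (-(l * j))) = (k : ℂ)⁻¹ * ZMod.stdAddChar (l * (i - j)) := by
      rw [mul_left_comm, ← AddChar.map_add_eq_mul]
      ring_nf
    simp [h, ← Finset.mul_sum, hsum, sub_eq_zero, hk]
  · simp [hab]

theorem equitable_decomposition_basic_circulant
    (k f r : ℕ) (hk : 1 ≤ k) [NeZero k]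
    (M : Matrix (Fin f ⊕ (ZMod k × Fin r)) (Fin f ⊕ (ZMod k × Fin r)) ℂ)
    (Cblk : ZMod k → Matrix (Fin r) (Fin r) ℂ)
    (H : Matrix (Fin f) (Fin r) ℂ) (L : Matrix (Fin r) (Fin f) ℂ)
    (hC : ∀ (i j : ZMod k) (a b : Fin r),
      M (Sum.inr (i, a)) (Sum.inr (j, b)) = Cblk (j - i) a b)
    (hH : ∀ (x : Fin f) (i : ZMod k) (a : Fin r),
      M (Sum.inl x) (Sum.inr (i, a)) = H x a)
    (hL : ∀ (i : ZMod k) (a : Fin r) (x : Fin f),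
      M (Sum.inr (i, a)) (Sum.inl x) = L a x)
    (F : Matrix (Fin f) (Fin f) ℂ)
    (hF : ∀ x y, F x y = M (Sum.inl x) (Sum.inl y))
    (ω : ℂ) (hω : ω = Complex.exp (2 * (Real.pi : ℂ) * Complex.I / (k : ℂ)))
    (B : ZMod k → Matrix (Fin r) (Fin r) ℂ)
    (hB : ∀ j : ZMod k, B j = ∑ m : ZMod k, ω ^ ((j * m : ZMod k).val) • Cblk m)
    (Mφ : Matrix (Fin f ⊕ Fin r) (Fin f ⊕ Fin r) ℂ)
    (hMφ : Mφ = Matrix.fromBlocks F ((k : ℂ) • H) L (B 0)) :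
    M.charpoly.roots =
      Mφ.charpoly.roots + ∑ j ∈ Finset.univ \ {(0 : ZMod k)}, (B j).charpoly.roots := by
  subst hω
  have hB' (j : ZMod k) : B j = ∑ m : ZMod k, (ZMod.stdAddChar (j * m) : ℂ) • Cblk m := by
    simp_rw [hB, ZMod.exp_pow_val_eq_stdAddChar]
  obtain ⟨V, hV⟩ := exists_blockFourier_mul_eq_one k (Fin f) (Fin r)
  have key : M.charpoly = Mφ.charpoly * ∏ j ∈ Finset.univ \ {(0 : ZMod k)}, (B j).charpoly := by
    rw [hMφ, ← charpoly_fromBlocks_single_coupling]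
    apply charpoly_eq_of_mul_eq_mul hV
    rw [blockFourier, ← fromBlocks_toBlocks M, fromBlocks_multiply, fromBlocks_multiply]
    simp only [Matrix.mul_zero, Matrix.zero_mul, Matrix.mul_one, Matrix.one_mul, add_zero,
      zero_add]
    congr 1
    · ext x y
      simp [toBlocks₁₁, hF]
    · ext x ⟨j, b⟩
      simp [toBlocks₁₂, mul_apply, hH, Fintype.sum_prod_type, ← Finset.sum_mul,
        ZMod.sum_stdAddChar_mul, mul_comm (H x b)]
    · ext ⟨i, a⟩ x
      simp [toBlocks₂₁, mul_apply, hL, Fintype.sum_prod_type_right]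
    · ext ⟨i, a⟩ ⟨j, b⟩
      have h : ∑ l : ZMod k, Cblk (l - i) a b * ZMod.stdAddChar (l * j) =
          ZMod.stdAddChar (i * j) * B j a b := by
        rw [hB', Matrix.sum_apply, Finset.mul_sum, ← Equiv.sum_comp (Equiv.addRight i)]
        refine Finset.sum_congr rfl fun l _ => ?_
        rw [Equiv.coe_addRight, add_sub_cancel_right, add_mul, AddChar.map_add_eq_mul,
          Matrix.smul_apply, smul_eq_mul, mul_comm l j]
        ring
      simpa [toBlocks₂₂, mul_apply, hC, Fintype.sum_prod_type] using h
  have hne : ∏ j ∈ Finset.univ \ {(0 : ZMod k)}, (B j).charpoly ≠ 0 :=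
    Finset.prod_ne_zero_iff.mpr fun j _ => (charpoly_monic _).ne_zero
  rw [key, roots_mul (mul_ne_zero (charpoly_monic _).ne_zero hne), roots_prod _ _ hne]
  rfl
end

section
/- In the normalized prime-power setting, the multiset of roots (with multiplicity) of the characteristic polynomial of M equals the multiset of roots of the characteristic polynomial of M̃ plus the sum over all units γ ∈ (ZMod (p^N))ˣ of the multisets of roots of the characteristic polynomials of the r × r matrices B_γ. -/
open Matrix Polynomial

namespace Matrix

theorem charpoly_blockDiagonal_s1 {R m o : Type*} [CommRing R] [Fintype m] [DecidableEq m]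
    [Fintype o] [DecidableEq o] (B : o → Matrix m m R) :
    (blockDiagonal B).charpoly = ∏ i, (B i).charpoly := by
  have h : (blockDiagonal B).charmatrix = blockDiagonal fun i => (B i).charmatrix := by
    ext ⟨i, k⟩ ⟨j, k'⟩ : 1
    by_cases hk : k = k'
    · subst hk
      simp [charmatrix_apply, diagonal_apply]
    · simp [blockDiagonal_apply, hk]
  rw [charpoly, h, det_blockDiagonal]
  rfl

/-- An intertwining relation `M * P = P * D` in which `P` has a left inverse and the index types
of `M` and `D` are equinumerous forces the characteristic polynomials to agree. -/
theorem charpoly_eq_of_mul_eq_mul_s1 {R m n : Type*} [CommRing R] [Fintype m] [DecidableEq m]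
    [Fintype n] [DecidableEq n] (hcard : Fintype.card m = Fintype.card n)
    {M : Matrix m m R} {D : Matrix n n R} {P : Matrix m n R} {Q : Matrix n m R}
    (hQP : Q * P = 1) (hMP : M * P = P * D) : M.charpoly = D.charpoly := by
  have hPQ : P * Q = 1 := (mul_eq_one_comm_of_equiv (Fintype.equivOfCardEq hcard.symm)).mp hQP
  calc M.charpoly = (M * P * Q).charpoly := by rw [Matrix.mul_assoc, hPQ, Matrix.mul_one]
    _ = (Q * (M * P)).charpoly := by
      rw [charpoly_mul_comm_of_le _ _ hcard.ge, hcard, Nat.sub_self, pow_zero, one_mul]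
    _ = D.charpoly := by rw [hMP, ← Matrix.mul_assoc, hQP, Matrix.one_mul]

end Matrix

namespace ZMod

theorem stdAddChar_eq_exp_pow_val {n : ℕ} [NeZero n] (j : ZMod n) :
    stdAddChar j = Complex.exp (2 * (Real.pi : ℂ) * Complex.I / n) ^ j.val := by
  have h := stdAddChar_coe (N := n) (j.val : ℤ)
  rw [Int.cast_natCast, natCast_zmod_val] at h
  rw [h, ← Complex.exp_nat_mul]
  congr 1
  push_cast
  ring

theorem apply_natCast_val_castHom {n k : ℕ} [NeZero n] [NeZero k] (hkn : k ∣ n) {α : Type*}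
    {g : ZMod n → α} (hg : ∀ i, g i = g (i + (k : ZMod n))) (i : ZMod n) :
    g (((castHom hkn (ZMod k) i).val : ℕ) : ZMod n) = g i := by
  have hmul (t : ℕ) (j : ZMod n) : g j = g (j + ((k * t : ℕ) : ZMod n)) := by
    induction t with
    | zero => simp
    | succ t ih => rw [ih, hg]; congr 1; push_cast; ring
  have hval : (castHom hkn (ZMod k) i).val = i.val % k := by
    rw [castHom_apply, cast_eq_val, val_natCast]
  rw [hval, hmul (i.val / k), ← Nat.cast_add, Nat.mod_add_div, natCast_zmod_val]

theorem card_filter_castHom_eq {n k p : ℕ} [NeZero n] [NeZero k] (hkn : k ∣ n) (hn : n = p * k)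
    (v : ZMod k) :
    (Finset.univ.filter fun i : ZMod n => castHom hkn (ZMod k) i = v).card = p := by
  have hsurj := castHom_surjective hkn
  have hconst (w : ZMod k) :
      (Finset.univ.filter fun i : ZMod n => castHom hkn (ZMod k) i = w).card =
        (Finset.univ.filter fun i : ZMod n => castHom hkn (ZMod k) i = v).card :=
    AddMonoidHom.card_fiber_eq_of_mem_range (castHom hkn (ZMod k)) (hsurj w) (hsurj v)
  have h := Finset.card_eq_sum_card_fiberwise (s := (Finset.univ : Finset (ZMod n)))
    (f := castHom hkn (ZMod k)) (t := Finset.univ) (by simp)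
  rw [Finset.sum_congr rfl fun w _ => hconst w] at h
  simp only [Finset.card_univ, ZMod.card, Finset.sum_const, smul_eq_mul] at h
  have hk : 0 < k := Nat.pos_of_neZero k
  refine Nat.eq_of_mul_eq_mul_left hk (h.symm.trans (hn.trans (mul_comm _ _)))

theorem sum_mul_stdAddChar_eq_zero {n : ℕ} [NeZero n] {g : ZMod n → ℂ} {c d : ZMod n}
    (hg : ∀ i, g i = g (i + c)) (hcd : d * c ≠ 0) :
    ∑ i, g i * stdAddChar (d * i) = 0 := by
  have h : ∑ i, g i * stdAddChar (d * i) =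
      (∑ i, g i * stdAddChar (d * i)) * stdAddChar (d * c) := by
    conv_lhs => rw [← Equiv.sum_comp (Equiv.addRight c)]
    rw [Finset.sum_mul]
    refine Finset.sum_congr rfl fun i _ => ?_
    rw [Equiv.coe_addRight, ← hg, mul_add, AddChar.map_add_eq_mul, mul_assoc]
  have hne : stdAddChar (d * c) ≠ 1 := fun h1 =>
    hcd (injective_stdAddChar (h1.trans (AddChar.map_zero_eq_one _).symm))
  by_contra h0
  exact hne (mul_left_cancel₀ h0 (by rw [mul_one, ← h]))

end ZMod

namespace Matrix

/-- Characteristic polynomial version of the equitable decomposition, for a circulant block part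
of size `n = p * k` whose number of units is `n - k`. -/
theorem charpoly_eq_mul_prod_of_periodic {α β : Type*} [Fintype α] [DecidableEq α]
    [Fintype β] [DecidableEq β] {n k p : ℕ} [NeZero n] [NeZero k] (hkn : k ∣ n) (hp : 1 < p)
    (hnk : n = p * k) (hφ : n = k + n.totient)
    {M : Matrix (α ⊕ (ZMod n × β)) (α ⊕ (ZMod n × β)) ℂ} {Cblk : ZMod n → Matrix β β ℂ}
    (hC : ∀ i j a b, M (Sum.inr (i, a)) (Sum.inr (j, b)) = Cblk (j - i) a b)
    (hHper : ∀ x i a,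
      M (Sum.inl x) (Sum.inr (i, a)) = M (Sum.inl x) (Sum.inr (i + (k : ZMod n), a)))
    (hLper : ∀ x i a,
      M (Sum.inr (i, a)) (Sum.inl x) = M (Sum.inr (i + (k : ZMod n), a)) (Sum.inl x))
    {F : Matrix α α ℂ} (hF : ∀ x y, F x y = M (Sum.inl x) (Sum.inl y))
    {H : Matrix α (ZMod k × β) ℂ}
    (hH : ∀ x v a, H x (v, a) = M (Sum.inl x) (Sum.inr (((v.val : ℕ) : ZMod n), a)))
    {L : Matrix (ZMod k × β) α ℂ}
    (hL : ∀ v a x, L (v, a) x = M (Sum.inr (((v.val : ℕ) : ZMod n), a)) (Sum.inl x))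
    {B₀ : Matrix (ZMod k × β) (ZMod k × β) ℂ}
    (hB₀ : ∀ v v' a b, B₀ (v, a) (v', b) =
      ∑ u ∈ Finset.univ.filter (fun u : ZMod n => ZMod.castHom hkn (ZMod k) u = v' - v),
        Cblk u a b)
    {Mt : Matrix (α ⊕ (ZMod k × β)) (α ⊕ (ZMod k × β)) ℂ}
    (hMt : Mt = fromBlocks F ((p : ℂ) • H) L B₀)
    {B : (ZMod n)ˣ → Matrix β β ℂ}
    (hB : ∀ γ : (ZMod n)ˣ, B γ = ∑ m : ZMod n, ZMod.stdAddChar ((γ : ZMod n) * m) • Cblk m) :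
    M.charpoly = Mt.charpoly * ∏ γ, (B γ).charpoly := by
  have hp0 : 0 < p := zero_lt_one.trans hp
  have hpC : (p : ℂ) ≠ 0 := Nat.cast_ne_zero.mpr hp0.ne'
  have hnC : (n : ℂ) ≠ 0 := Nat.cast_ne_zero.mpr (NeZero.ne n)
  have hkpos : 0 < k := Nat.pos_of_neZero k
  have hk0 : (k : ZMod n) ≠ 0 := by
    rw [Ne, ZMod.natCast_eq_zero_iff]
    intro h
    have h1 := Nat.le_of_dvd hkpos h
    nlinarith
  have huk (γ : (ZMod n)ˣ) : (γ : ZMod n) * (k : ZMod n) ≠ 0 := by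
    rwa [Ne, Units.mul_right_eq_zero]
  let π := ZMod.castHom hkn (ZMod k)
  have hπ (i : ZMod n) : π (i + (k : ZMod n)) = π i := by simp
  let ψ : AddChar (ZMod n) ℂ := ZMod.stdAddChar
  let s : Matrix (ZMod n) (ZMod k) ℂ := of fun i v => if π i = v then 1 else 0
  let sInv : Matrix (ZMod k) (ZMod n) ℂ := of fun v i => if π i = v then (p : ℂ)⁻¹ else 0
  let t : Matrix (ZMod n) (ZMod n)ˣ ℂ := of fun i γ => ψ (γ * i)
  let tInv : Matrix (ZMod n)ˣ (ZMod n) ℂ := of fun γ i => (n : ℂ)⁻¹ * ψ (-γ * i)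
  have hss : sInv * s = 1 := by
    ext v w
    rw [mul_apply]
    simp only [s, sInv, of_apply, mul_ite, mul_one, mul_zero, one_apply]
    by_cases hvw : v = w
    · subst hvw
      simp only [if_true, ← ite_and, and_self]
      rw [← Finset.sum_filter, Finset.sum_const, ZMod.card_filter_castHom_eq hkn hnk,
        nsmul_eq_mul, mul_inv_cancel₀ hpC]
    · rw [if_neg hvw]
      refine Finset.sum_eq_zero fun i _ => ?_
      split_ifs with h1 h2
      · exact absurd (h2.symm.trans h1) hvw
      all_goals rfl
  have hst : sInv * t = 0 := by
    ext v γ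
    rw [mul_apply]
    exact ZMod.sum_mul_stdAddChar_eq_zero (c := (k : ZMod n))
      (fun i => by simp only [sInv, of_apply, hπ]) (huk γ)
  have hts : tInv * s = 0 := by
    ext γ v
    rw [mul_apply, Matrix.zero_apply]
    have h := ZMod.sum_mul_stdAddChar_eq_zero (g := fun i => (n : ℂ)⁻¹ * s i v)
      (c := (k : ZMod n)) (d := -γ) (fun i => by simp only [s, of_apply, hπ])
      (by rw [neg_mul]; exact neg_ne_zero.mpr (huk γ))
    rw [← h]
    refine Finset.sum_congr rfl fun i _ => ?_
    simp only [tInv, of_apply]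
    ring
  have htt : tInv * t = 1 := by
    ext γ δ
    rw [mul_apply, one_apply]
    have h := AddChar.sum_mulShift ((δ : ZMod n) - γ) (ZMod.isPrimitive_stdAddChar n)
    have h2 : ∑ i, tInv γ i * t i δ = (n : ℂ)⁻¹ * ∑ i, ψ (i * ((δ : ZMod n) - γ)) := by
      rw [Finset.mul_sum]
      refine Finset.sum_congr rfl fun i _ => ?_
      simp only [t, tInv, of_apply]
      rw [mul_assoc, ← AddChar.map_add_eq_mul]
      congr 2
      ring
    rw [h2, h, ZMod.card]
    simp only [sub_eq_zero, Units.val_inj, eq_comm (a := δ)]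
    split_ifs
    · exact inv_mul_cancel₀ hnC
    · simp
  let S := kroneckerMap (· * ·) s (1 : Matrix β β ℂ)
  let SInv := kroneckerMap (· * ·) sInv (1 : Matrix β β ℂ)
  let T := kroneckerMap (· * ·) t (1 : Matrix β β ℂ)
  let TInv := kroneckerMap (· * ·) tInv (1 : Matrix β β ℂ)
  have hSS : SInv * S = 1 := by
    simp only [S, SInv, ← mul_kronecker_mul, hss, Matrix.one_mul, one_kronecker_one]
  have hST : SInv * T = 0 := by
    simp only [SInv, T, ← mul_kronecker_mul, hst, zero_kronecker]
  have hTS : TInv * S = 0 := by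
    simp only [TInv, S, ← mul_kronecker_mul, hts, zero_kronecker]
  have hTT : TInv * T = 1 := by
    simp only [T, TInv, ← mul_kronecker_mul, htt, Matrix.one_mul, one_kronecker_one]
  let Mh := M.toBlocks₁₂
  let Ml := M.toBlocks₂₁
  let Mc := M.toBlocks₂₂
  have hM : M = fromBlocks F Mh Ml Mc := by
    have hF' : F = M.toBlocks₁₁ := by ext x y; exact hF x y
    rw [hF', fromBlocks_toBlocks]
  have hHlift (x : α) (i : ZMod n) (a : β) : Mh x (i, a) = H x (π i, a) := by
    rw [hH]
    exact (ZMod.apply_natCast_val_castHom hkn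
      (g := fun j => M (Sum.inl x) (Sum.inr (j, a))) (fun j => hHper x j a) i).symm
  have hLlift (x : α) (i : ZMod n) (a : β) : Ml (i, a) x = L (π i, a) x := by
    rw [hL]
    exact (ZMod.apply_natCast_val_castHom hkn
      (g := fun j => M (Sum.inr (j, a)) (Sum.inl x)) (fun j => hLper x j a) i).symm
  have hMc (i j : ZMod n) (a b : β) : Mc (i, a) (j, b) = Cblk (j - i) a b := hC i j a b
  have hMhS : Mh * S = (p : ℂ) • H := by
    ext x ⟨v, b⟩
    rw [mul_apply, Fintype.sum_prod_type]
    simp only [S, kroneckerMap_apply, one_apply, mul_ite, mul_one, mul_zero, Finset.sum_ite_eq',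
      Finset.mem_univ, if_true, s, of_apply, hHlift]
    rw [← Finset.sum_filter, Finset.sum_congr rfl (g := fun _ => H x (v, b)), Finset.sum_const,
      ZMod.card_filter_castHom_eq hkn hnk, Matrix.smul_apply, nsmul_eq_mul, smul_eq_mul]
    intro i hi
    rw [(Finset.mem_filter.mp hi).2]
  have hMhT : Mh * T = 0 := by
    ext x ⟨γ, b⟩
    rw [mul_apply, Fintype.sum_prod_type]
    simp only [T, kroneckerMap_apply, one_apply, mul_ite, mul_one, mul_zero, Finset.sum_ite_eq',
      Finset.mem_univ, if_true]
    exact ZMod.sum_mul_stdAddChar_eq_zero (c := (k : ZMod n)) (fun i => hHper x i b) (huk γ)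
  have hSL : S * L = Ml := by
    ext ⟨i, a⟩ x
    rw [mul_apply, Fintype.sum_prod_type]
    simp [S, kroneckerMap_apply, one_apply, s, hLlift]
  have hMcS : Mc * S = S * B₀ := by
    ext ⟨i, a⟩ ⟨v, b⟩
    rw [mul_apply, mul_apply, Fintype.sum_prod_type, Fintype.sum_prod_type]
    simp only [S, kroneckerMap_apply, one_apply, mul_ite, mul_one, mul_zero, Finset.sum_ite_eq',
      Finset.sum_ite_eq, Finset.mem_univ, if_true, s, of_apply, hMc, hB₀, ite_mul, one_mul,
      zero_mul]
    rw [← Equiv.sum_comp (Equiv.addRight i), Finset.sum_filter]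
    refine Finset.sum_congr rfl fun u _ => ?_
    simp only [Equiv.coe_addRight, add_sub_cancel_right, map_add, eq_sub_iff_add_eq, π]
  have hBψ (γ : (ZMod n)ˣ) (a b : β) : B γ a b = ∑ m, ψ (γ * m) * Cblk m a b := by
    rw [hB, sum_apply]
    rfl
  let D := reindex (Equiv.prodComm β (ZMod n)ˣ) (Equiv.prodComm β (ZMod n)ˣ)
    (blockDiagonal B)
  have hMcT : Mc * T = T * D := by
    ext ⟨i, a⟩ ⟨γ, b⟩
    rw [mul_apply, mul_apply, Fintype.sum_prod_type, Fintype.sum_prod_type]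
    simp only [T, D, kroneckerMap_apply, one_apply, mul_ite, mul_one, mul_zero,
      Finset.sum_ite_eq', Finset.mem_univ, if_true, t, of_apply, hMc, ite_mul, zero_mul,
      reindex_apply, submatrix_apply, Equiv.prodComm_symm, Equiv.prodComm_apply,
      Prod.swap_prod_mk, blockDiagonal_apply, hBψ]
    rw [Finset.sum_comm]
    simp only [Finset.sum_ite_eq', Finset.sum_ite_eq, Finset.mem_univ, if_true]
    rw [← Equiv.sum_comp (Equiv.addRight i), Finset.mul_sum]
    refine Finset.sum_congr rfl fun u _ => ?_
    rw [Equiv.coe_addRight, add_sub_cancel_right, mul_add, AddChar.map_add_eq_mul]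
    ring
  let P : Matrix (α ⊕ ZMod n × β) ((α ⊕ ZMod k × β) ⊕ (ZMod n)ˣ × β) ℂ :=
    fromCols (fromBlocks 1 0 0 S) (fromRows (0 : Matrix α _ ℂ) T)
  let Q : Matrix ((α ⊕ ZMod k × β) ⊕ (ZMod n)ˣ × β) (α ⊕ ZMod n × β) ℂ :=
    fromRows (fromBlocks 1 0 0 SInv) (fromCols (0 : Matrix _ α ℂ) TInv)
  have hQP : Q * P = 1 := by
    have h1 : fromBlocks (1 : Matrix α α ℂ) 0 0 SInv * fromBlocks (1 : Matrix α α ℂ) 0 0 S = 1 := by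
      simp [fromBlocks_multiply, hSS]
    have h2 : fromBlocks (1 : Matrix α α ℂ) 0 0 SInv * fromRows (0 : Matrix α _ ℂ) T = 0 := by
      simp [fromBlocks_mul_fromRows, hST]
    have h3 : fromCols (0 : Matrix _ α ℂ) TInv * fromBlocks (1 : Matrix α α ℂ) 0 0 S = 0 := by
      simp [fromCols_mul_fromBlocks, hTS]
    have h4 : fromCols (0 : Matrix _ α ℂ) TInv * fromRows (0 : Matrix α _ ℂ) T = 1 := by
      simp [fromCols_mul_fromRows, hTT]
    rw [fromRows_mul_fromCols, h1, h2, h3, h4, fromBlocks_one]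
  have hMP : M * P = P * fromBlocks Mt 0 0 D := by
    rw [mul_fromCols, fromCols_mul_fromBlocks, hM, hMt]
    simp [fromBlocks_multiply, fromBlocks_mul_fromRows, fromRows_mul, hMhS, hMhT, hSL, hMcS, hMcT]
  have hcard : Fintype.card (α ⊕ ZMod n × β) =
      Fintype.card ((α ⊕ ZMod k × β) ⊕ (ZMod n)ˣ × β) := by
    simp only [Fintype.card_sum, Fintype.card_prod, ZMod.card, ZMod.card_units_eq_totient]
    rw [add_assoc, ← add_mul, ← hφ]
  rw [charpoly_eq_of_mul_eq_mul_s1 hcard hQP hMP, charpoly_fromBlocks_zero₁₂, charpoly_reindex,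
    charpoly_blockDiagonal_s1]

end Matrix

theorem equitable_decomposition_prime_power_step_spectrum
    (p N f r : ℕ) (hp : p.Prime) (hN : 1 ≤ N)
    [NeZero (p ^ N)] [NeZero (p ^ (N - 1))]
    (M : Matrix (Fin f ⊕ (ZMod (p ^ N) × Fin r)) (Fin f ⊕ (ZMod (p ^ N) × Fin r)) ℂ)
    (Cblk : ZMod (p ^ N) → Matrix (Fin r) (Fin r) ℂ)
    (hC : ∀ (i j : ZMod (p ^ N)) (a b : Fin r),
      M (Sum.inr (i, a)) (Sum.inr (j, b)) = Cblk (j - i) a b)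
    (hHper : ∀ (x : Fin f) (i : ZMod (p ^ N)) (a : Fin r),
      M (Sum.inl x) (Sum.inr (i, a)) =
        M (Sum.inl x) (Sum.inr (i + ((p ^ (N - 1) : ℕ) : ZMod (p ^ N)), a)))
    (hLper : ∀ (x : Fin f) (i : ZMod (p ^ N)) (a : Fin r),
      M (Sum.inr (i, a)) (Sum.inl x) =
        M (Sum.inr (i + ((p ^ (N - 1) : ℕ) : ZMod (p ^ N)), a)) (Sum.inl x))
    (F : Matrix (Fin f) (Fin f) ℂ)
    (hF : ∀ x y, F x y = M (Sum.inl x) (Sum.inl y))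
    (H : Matrix (Fin f) (ZMod (p ^ (N - 1)) × Fin r) ℂ)
    (hH : ∀ x v a, H x (v, a) = M (Sum.inl x) (Sum.inr (((v.val : ℕ) : ZMod (p ^ N)), a)))
    (L : Matrix (ZMod (p ^ (N - 1)) × Fin r) (Fin f) ℂ)
    (hL : ∀ v a x, L (v, a) x = M (Sum.inr (((v.val : ℕ) : ZMod (p ^ N)), a)) (Sum.inl x))
    (B₀ : Matrix (ZMod (p ^ (N - 1)) × Fin r) (ZMod (p ^ (N - 1)) × Fin r) ℂ)
    (hB₀ : ∀ v v' a b, B₀ (v, a) (v', b) =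
      ∑ u ∈ Finset.univ.filter (fun u : ZMod (p ^ N) =>
          ZMod.castHom (pow_dvd_pow p (Nat.sub_le N 1)) (ZMod (p ^ (N - 1))) u = v' - v),
        Cblk u a b)
    (Mt : Matrix (Fin f ⊕ (ZMod (p ^ (N - 1)) × Fin r))
        (Fin f ⊕ (ZMod (p ^ (N - 1)) × Fin r)) ℂ)
    (hMt : Mt = Matrix.fromBlocks F ((p : ℂ) • H) L B₀)
    (ω : ℂ) (hω : ω = Complex.exp (2 * (Real.pi : ℂ) * Complex.I / ((p : ℂ) ^ N)))
    (B : (ZMod (p ^ N))ˣ → Matrix (Fin r) (Fin r) ℂ)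
    (hB : ∀ γ, B γ = ∑ m : ZMod (p ^ N), ω ^ (((γ : ZMod (p ^ N)) * m).val) • Cblk m) :
    M.charpoly.roots = Mt.charpoly.roots + ∑ γ : (ZMod (p ^ N))ˣ, (B γ).charpoly.roots := by
  have hk : p ^ N = p * p ^ (N - 1) := by rw [← pow_succ', Nat.sub_add_cancel hN]
  have hφ : p ^ N = p ^ (N - 1) + (p ^ N).totient := by
    rw [Nat.totient_prime_pow hp hN, hk, mul_comm, Nat.mul_sub_one, Nat.add_sub_of_le]
    exact Nat.le_mul_of_pos_right _ hp.pos
  have hB' (γ : (ZMod (p ^ N))ˣ) :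
      B γ = ∑ m, ZMod.stdAddChar ((γ : ZMod (p ^ N)) * m) • Cblk m := by
    simp only [hB, ZMod.stdAddChar_eq_exp_pow_val, hω, Nat.cast_pow]
  rw [Matrix.charpoly_eq_mul_prod_of_periodic (pow_dvd_pow p (Nat.sub_le N 1)) hp.one_lt hk hφ
    hC hHper hLper hF hH hL hB₀ hMt hB']
  have hprod : ∏ γ, (B γ).charpoly ≠ 0 :=
    Finset.prod_ne_zero_iff.mpr fun γ _ => (charpoly_monic (B γ)).ne_zero
  rw [roots_mul (mul_ne_zero (charpoly_monic Mt).ne_zero hprod), roots_prod _ _ hprod]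
  rfl
end

section
/- Fix a prime p, an integer N ≥ 1, and a natural number r. Let Cblk : ZMod (p^N) → Matrix (Fin r) (Fin r) ℂ and let C be the block-circulant matrix indexed by ZMod (p^N) × Fin r with C (i,a) (j,b) = Cblk (j−i) a b. Define R : Matrix (ZMod (p^{N−1}) × Fin r) (ZMod (p^N) × Fin r) ℂ by R (v,a) (i,b) = 1 if the reduction of i modulo p^{N−1} equals v and a = b, and 0 otherwise, and define B₀ indexed by ZMod (p^{N−1}) × Fin r by B₀ (v,a) (v',b) = Σ over all u ∈ ZMod (p^N) whose reduction modulo p^{N−1} equals v'−v of Cblk u a b. Then R * C * Rᵀ = (p : ℂ) • B₀. -/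
open Matrix

/-- Every fibre of a surjective homomorphism of finite additive groups has the same cardinality,
namely the quotient of the orders of the groups. -/
theorem card_mul_card_fiber_of_surjective {G H : Type*} [AddGroup G] [AddGroup H]
    [Fintype G] [Fintype H] [DecidableEq H] (f : G →+ H) (hf : Function.Surjective f) (v : H) :
    Fintype.card H * (Finset.univ.filter (fun g => f g = v)).card = Fintype.card G := by
  have h := Finset.card_eq_sum_card_fiberwise (f := f) (s := Finset.univ) (t := Finset.univ)
    (fun _ _ => Finset.mem_coe.2 (Finset.mem_univ _))
  rw [← Finset.card_univ (α := G), h, Finset.sum_congr rfl fun w _ =>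
    AddMonoidHom.card_fiber_eq_of_mem_range f (hf w) (hf v)]
  simp

/-- Summing a function of the difference over a pair of fibres of a homomorphism. -/
theorem sum_fiber_sum_fiber_sub {G H M : Type*} [AddCommGroup G] [AddCommGroup H]
    [AddCommMonoid M] [Fintype G] [DecidableEq H] (f : G →+ H) (F : G → M) (v v' : H) :
    ∑ i with f i = v, ∑ j with f j = v', F (j - i) =
      (Finset.univ.filter (fun g => f g = v)).card • ∑ u with f u = v' - v, F u := by
  rw [← Finset.sum_const]
  refine Finset.sum_congr rfl fun i hi => ?_
  have hi : f i = v := by simpa using hi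
  refine Finset.sum_bij' (fun j _ => j - i) (fun u _ => u + i) ?_ ?_ ?_ ?_ ?_ <;>
    simp +contextual [hi]

theorem R_mul_C_mul_Rt_eq_p_smul_B0
    (p N r : ℕ) (hp : p.Prime) (hN : 1 ≤ N)
    [NeZero (p ^ N)] [NeZero (p ^ (N - 1))]
    (Cblk : ZMod (p ^ N) → Matrix (Fin r) (Fin r) ℂ)
    (C : Matrix (ZMod (p ^ N) × Fin r) (ZMod (p ^ N) × Fin r) ℂ)
    (hC : ∀ (i j : ZMod (p ^ N)) (a b : Fin r), C (i, a) (j, b) = Cblk (j - i) a b)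
    (R : Matrix (ZMod (p ^ (N - 1)) × Fin r) (ZMod (p ^ N) × Fin r) ℂ)
    (hR : ∀ (v : ZMod (p ^ (N - 1))) (a : Fin r) (i : ZMod (p ^ N)) (b : Fin r),
      R (v, a) (i, b) =
        if ZMod.castHom (pow_dvd_pow p (Nat.sub_le N 1)) (ZMod (p ^ (N - 1))) i = v ∧ a = b
        then 1 else 0)
    (B₀ : Matrix (ZMod (p ^ (N - 1)) × Fin r) (ZMod (p ^ (N - 1)) × Fin r) ℂ)
    (hB₀ : ∀ v v' a b, B₀ (v, a) (v', b) =
      ∑ u ∈ Finset.univ.filter (fun u : ZMod (p ^ N) =>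
          ZMod.castHom (pow_dvd_pow p (Nat.sub_le N 1)) (ZMod (p ^ (N - 1))) u = v' - v),
        Cblk u a b) :
    R * C * R.transpose = (p : ℂ) • B₀ := by
  let f := ZMod.castHom (pow_dvd_pow p (Nat.sub_le N 1)) (ZMod (p ^ (N - 1)))
  ext ⟨v, a⟩ ⟨v', b⟩
  have hcard : (Finset.univ.filter (fun i => f i = v)).card = p := by
    have h := card_mul_card_fiber_of_surjective f.toAddMonoidHom
      (ZMod.castHom_surjective (pow_dvd_pow p (Nat.sub_le N 1))) v
    rw [ZMod.card, ZMod.card] at h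
    exact Nat.eq_of_mul_eq_mul_left (pow_pos hp.pos _)
      (h.trans (pow_sub_one_mul (by lia) p).symm)
  have hrow (w : ZMod (p ^ (N - 1))) (c : Fin r) (g : ZMod (p ^ N) × Fin r → ℂ) :
      ∑ x, R (w, c) x * g x = ∑ i with f i = w, g (i, c) := by
    rw [Fintype.sum_prod_type, Finset.sum_filter]
    refine Finset.sum_congr rfl fun i _ => ?_
    by_cases hi : f i = w <;>
      simp [hR, show ZMod.castHom _ _ i = f i from rfl, hi, -ZMod.castHom_apply]
  have hsum := sum_fiber_sum_fiber_sub f.toAddMonoidHom (fun u => Cblk u a b) v v'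
  calc (R * C * R.transpose) (v, a) (v', b)
      = ∑ j with f j = v', ∑ i with f i = v, Cblk (j - i) a b := by
        simp only [Matrix.mul_apply, Matrix.transpose_apply, mul_comm _ (R (v', b) _), hrow, hC]
    _ = ∑ i with f i = v, ∑ j with f j = v', Cblk (j - i) a b := Finset.sum_comm
    _ = (Finset.univ.filter (fun i => f i = v)).card • ∑ u with f u = v' - v, Cblk u a b := hsum
    _ = ((p : ℂ) • B₀) (v, a) (v', b) := by
        rw [hcard, Matrix.smul_apply, hB₀, nsmul_eq_mul, smul_eq_mul]
end

section
/- In the normalized prime-power setting, suppose additionally that α is a permutation of Fin f with α^{p^{N−1}} = 1 and that M (Sum.map α σ u) (Sum.map α σ v) = M u v for all u, v, where σ (i,a) = (i+1, a) on ZMod (p^N) × Fin r. Let σ' be the permutation of ZMod (p^{N−1}) × Fin r given by σ' (v,a) = (v+1, a). Then M̃ (Sum.map α σ' u) (Sum.map α σ' v) = M̃ u v for all u, v in Fin f ⊕ (ZMod (p^{N−1}) × Fin r); that is, M̃ is compatible with the permutation Sum.map α σ', whose order divides p^{N−1}. -/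
open Matrix

theorem apply_natCast_mod_of_periodic {R X : Type*} [AddMonoidWithOne R] (g : R → X) (d : ℕ)
    (hg : ∀ i, g i = g (i + (d : R))) (m : ℕ) : g ((m % d : ℕ) : R) = g (m : R) := by
  have key (k q : ℕ) : g ((k + d * q : ℕ) : R) = g (k : R) := by
    induction q with
    | zero => simp
    | succ q ih => rw [← ih, hg ((k + d * q : ℕ) : R), ← Nat.cast_add, Nat.mul_succ, add_assoc]
  rw [← key (m % d) (m / d), Nat.mod_add_div]

theorem apply_val_add_one_of_periodic {R X : Type*} [AddMonoidWithOne R] (g : R → X) (d : ℕ)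
    [NeZero d] (hg : ∀ i, g i = g (i + (d : R))) (v : ZMod d) :
    g ((v + 1).val : R) = g ((v.val : R) + 1) := by
  rw [ZMod.val_add, ZMod.val_one_eq_one_mod, Nat.add_mod_mod,
    apply_natCast_mod_of_periodic g d hg, Nat.cast_add, Nat.cast_one]

theorem perm_pow_apply_of_shift {R ι : Type*} [AddMonoidWithOne R] (σ : Equiv.Perm (R × ι))
    (hσ : ∀ v a, σ (v, a) = (v + 1, a)) (k : ℕ) (v : R) (a : ι) :
    (σ ^ k) (v, a) = (v + (k : R), a) := by
  induction k with
  | zero => simp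
  | succ k ih => rw [pow_succ', Equiv.Perm.mul_apply, ih, hσ, Nat.cast_succ, add_assoc]

theorem divisor_part_has_smaller_automorphism
    (p N f r : ℕ) (hp : p.Prime) (hN : 1 ≤ N)
    [NeZero (p ^ N)] [NeZero (p ^ (N - 1))]
    (M : Matrix (Fin f ⊕ (ZMod (p ^ N) × Fin r)) (Fin f ⊕ (ZMod (p ^ N) × Fin r)) ℂ)
    (Cblk : ZMod (p ^ N) → Matrix (Fin r) (Fin r) ℂ)
    (hC : ∀ (i j : ZMod (p ^ N)) (a b : Fin r),
      M (Sum.inr (i, a)) (Sum.inr (j, b)) = Cblk (j - i) a b)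
    (hHper : ∀ (x : Fin f) (i : ZMod (p ^ N)) (a : Fin r),
      M (Sum.inl x) (Sum.inr (i, a)) =
        M (Sum.inl x) (Sum.inr (i + ((p ^ (N - 1) : ℕ) : ZMod (p ^ N)), a)))
    (hLper : ∀ (x : Fin f) (i : ZMod (p ^ N)) (a : Fin r),
      M (Sum.inr (i, a)) (Sum.inl x) =
        M (Sum.inr (i + ((p ^ (N - 1) : ℕ) : ZMod (p ^ N)), a)) (Sum.inl x))
    (F : Matrix (Fin f) (Fin f) ℂ)
    (hF : ∀ x y, F x y = M (Sum.inl x) (Sum.inl y))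
    (H : Matrix (Fin f) (ZMod (p ^ (N - 1)) × Fin r) ℂ)
    (hH : ∀ x v a, H x (v, a) = M (Sum.inl x) (Sum.inr (((v.val : ℕ) : ZMod (p ^ N)), a)))
    (L : Matrix (ZMod (p ^ (N - 1)) × Fin r) (Fin f) ℂ)
    (hL : ∀ v a x, L (v, a) x = M (Sum.inr (((v.val : ℕ) : ZMod (p ^ N)), a)) (Sum.inl x))
    (B₀ : Matrix (ZMod (p ^ (N - 1)) × Fin r) (ZMod (p ^ (N - 1)) × Fin r) ℂ)
    (hB₀ : ∀ v v' a b, B₀ (v, a) (v', b) =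
      ∑ u ∈ Finset.univ.filter (fun u : ZMod (p ^ N) =>
          ZMod.castHom (pow_dvd_pow p (Nat.sub_le N 1)) (ZMod (p ^ (N - 1))) u = v' - v),
        Cblk u a b)
    (Mt : Matrix (Fin f ⊕ (ZMod (p ^ (N - 1)) × Fin r))
        (Fin f ⊕ (ZMod (p ^ (N - 1)) × Fin r)) ℂ)
    (hMt : Mt = Matrix.fromBlocks F ((p : ℂ) • H) L B₀)
    (α : Equiv.Perm (Fin f)) (hα : α ^ (p ^ (N - 1)) = 1)
    (σ : Equiv.Perm (ZMod (p ^ N) × Fin r))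
    (hσ : ∀ (i : ZMod (p ^ N)) (a : Fin r), σ (i, a) = (i + 1, a))
    (hM : ∀ u v, M (Sum.map (⇑α) (⇑σ) u) (Sum.map (⇑α) (⇑σ) v) = M u v)
    (σ' : Equiv.Perm (ZMod (p ^ (N - 1)) × Fin r))
    (hσ' : ∀ (v : ZMod (p ^ (N - 1))) (a : Fin r), σ' (v, a) = (v + 1, a)) :
    (∀ u v, Mt (Sum.map (⇑α) (⇑σ') u) (Sum.map (⇑α) (⇑σ') v) = Mt u v) ∧
    orderOf (Equiv.sumCongr α σ') ∣ p ^ (N - 1) := by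
  subst hMt
  refine ⟨?_, orderOf_dvd_of_pow_eq_one ?_⟩
  · rintro (x | ⟨v, a⟩) (y | ⟨w, b⟩)
    · simpa [hF] using hM (Sum.inl x) (Sum.inl y)
    · have h := hM (Sum.inl x) (Sum.inr (((w.val : ℕ) : ZMod (p ^ N)), b))
      simp only [Sum.map_inl, Sum.map_inr, hσ] at h
      simp only [Sum.map_inl, Sum.map_inr, hσ', fromBlocks_apply₁₂, Matrix.smul_apply, hH]
      rw [apply_val_add_one_of_periodic (fun i => M (Sum.inl (α x)) (Sum.inr (i, b)))
        (p ^ (N - 1)) (fun i => hHper (α x) i b) w, h]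
    · have h := hM (Sum.inr (((v.val : ℕ) : ZMod (p ^ N)), a)) (Sum.inl y)
      simp only [Sum.map_inl, Sum.map_inr, hσ] at h
      simp only [Sum.map_inl, Sum.map_inr, hσ', fromBlocks_apply₂₁, hL]
      rw [apply_val_add_one_of_periodic (fun i => M (Sum.inr (i, a)) (Sum.inl (α y)))
        (p ^ (N - 1)) (fun i => hLper (α y) i a) v, h]
    · simp only [Sum.map_inr, hσ', fromBlocks_apply₂₂, hB₀, add_sub_add_right_eq_sub]
  · have hσ'pow : σ' ^ p ^ (N - 1) = 1 := by
      ext1 ⟨v, a⟩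
      rw [perm_pow_apply_of_shift σ' hσ', ZMod.natCast_self, add_zero, Equiv.Perm.one_apply]
    change (Equiv.Perm.sumCongrHom _ _ (α, σ')) ^ p ^ (N - 1) = 1
    rw [← map_pow, Prod.pow_mk, hα, hσ'pow, Prod.mk_one_one, map_one]
end

section
/- Let V be a finite type, M : Matrix V V ℂ, and φ a permutation of V of order p^N for some prime p and N ≥ 1, such that M (φ i) (φ j) = M i j for all i, j. Let M_φ be the divisor matrix of M associated with φ (for any choice of orbit representatives). Then the characteristic polynomial of M_φ divides the characteristic polynomial of M in ℂ[X]; in particular every eigenvalue of M_φ is an eigenvalue of M with at least the same multiplicity. -/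
open Matrix Polynomial

theorem Matrix.charpoly_dvd_charpoly_of_mul_fromRows_one {R o c : Type*} [CommRing R]
    [Fintype o] [DecidableEq o] [Fintype c] [DecidableEq c]
    (A : Matrix (o ⊕ c) (o ⊕ c) R) (Q : Matrix c o R) (B : Matrix o o R)
    (h : A * fromRows (1 : Matrix o o R) Q = fromRows (1 : Matrix o o R) Q * B) : B.charpoly ∣ A.charpoly := by
  let T : Matrix (o ⊕ c) (o ⊕ c) R := fromBlocks 1 0 Q 1
  let T' : Matrix (o ⊕ c) (o ⊕ c) R := fromBlocks 1 0 (-Q) 1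
  have hTT' : T * T' = 1 := by simp [T, T', fromBlocks_multiply]
  have hconj : T' * (A * T) =
      fromBlocks B A.toBlocks₁₂ 0 (-Q * A.toBlocks₁₂ + A.toBlocks₂₂) := by
    rw [← fromBlocks_toBlocks A, fromBlocks_mul_fromRows, fromRows_mul, fromRows_inj.eq_iff] at h
    obtain ⟨h₁, h₂⟩ := h
    rw [← fromBlocks_toBlocks A]
    simp_all [T, T', fromBlocks_multiply]
  have hchar : A.charpoly = (T' * (A * T)).charpoly := by
    rw [charpoly_mul_comm, Matrix.mul_assoc, hTT', Matrix.mul_one]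
  rw [hchar, hconj, charpoly_fromBlocks_zero₂₁]
  exact dvd_mul_right _ _

theorem Matrix.charpoly_dvd_charpoly_of_mul_eq_mul {R m o : Type*} [CommRing R]
    [Fintype m] [DecidableEq m] [Fintype o] [DecidableEq o]
    (A : Matrix m m R) (P : Matrix m o R) (B : Matrix o o R) (h : A * P = P * B)
    (s : o → m) (hs : Function.Injective s) (hP : P.submatrix s id = 1) :
    B.charpoly ∣ A.charpoly := by
  classical
  let e : o ⊕ ((Set.range s)ᶜ : Set m) ≃ m :=
    ((Equiv.ofInjective s hs).sumCongr (Equiv.refl _)).trans (Equiv.Set.sumCompl (Set.range s))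
  have he : P.submatrix e id = fromRows 1 (P.submatrix (fun x => e (Sum.inr x)) id) := by
    rw [← hP]
    ext (i | i) j <;> simp [e]
  rw [← charpoly_reindex e.symm A, reindex_apply, Equiv.symm_symm]
  refine charpoly_dvd_charpoly_of_mul_fromRows_one _
    (P.submatrix (fun x => e (Sum.inr x)) id) B ?_
  rw [← he, submatrix_mul_equiv, h]
  ext i j
  simp [mul_apply]

theorem Equiv.Perm.sum_filter_pow_apply {R V O : Type*} [AddCommMonoid R] [Fintype V]
    [DecidableEq O] (M : Matrix V V R) (φ : Equiv.Perm V)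
    (hM : ∀ i j, M (φ i) (φ j) = M i j) (orb : V → O) (horb : ∀ v, orb (φ v) = orb v)
    (k : ℕ) (u : V) (o : O) :
    ∑ v with orb v = o, M ((φ ^ k) u) v = ∑ v with orb v = o, M u v := by
  induction k with
  | zero => simp
  | succ k ih =>
    rw [← ih, pow_succ', Equiv.Perm.mul_apply]
    refine (Finset.sum_equiv φ (fun v => ?_) fun v _ => ?_).symm
    · simp [horb]
    · rw [hM]

theorem divisor_matrix_charpoly_dvd_of_prime_power_automorphism
    (V : Type*) [Fintype V] [DecidableEq V]
    (M : Matrix V V ℂ) (φ : Equiv.Perm V)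
    (p N : ℕ) (hp : p.Prime) (hN : 1 ≤ N) (hord : orderOf φ = p ^ N)
    (hM : ∀ i j, M (φ i) (φ j) = M i j)
    (O : Type*) [Fintype O] [DecidableEq O]
    (orb : V → O) (s : O → V)
    (horb : ∀ u v : V, orb u = orb v ↔ ∃ k : ℕ, v = (φ ^ k) u)
    (hs : ∀ o, orb (s o) = o)
    (Mφ : Matrix O O ℂ)
    (hMφ : ∀ o o', Mφ o o' = ∑ v ∈ Finset.univ.filter (fun v => orb v = o'), M (s o) v) :
    Mφ.charpoly ∣ M.charpoly ∧
    ∀ z : ℂ, Multiset.count z Mφ.charpoly.roots ≤ Multiset.count z M.charpoly.roots := by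
  have hφ (v : V) : orb (φ v) = orb v := ((horb v (φ v)).2 ⟨1, by simp⟩).symm
  let P : Matrix V O ℂ := Matrix.of fun v o => if orb v = o then 1 else 0
  have hMP : M * P = P * Mφ := by
    ext u o
    obtain ⟨k, hk⟩ := (horb (s (orb u)) u).1 (hs _)
    have hsum := Equiv.Perm.sum_filter_pow_apply M φ hM orb hφ k (s (orb u)) o
    rw [← hk, ← hMφ] at hsum
    simpa [mul_apply, P, Finset.sum_filter] using hsum
  have hdvd : Mφ.charpoly ∣ M.charpoly := by
    refine charpoly_dvd_charpoly_of_mul_eq_mul M P Mφ hMP s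
      (Function.LeftInverse.injective hs) ?_
    ext i j
    simp [P, hs, one_apply]
  exact ⟨hdvd, fun z =>
    Multiset.count_le_of_le z (roots.le_of_dvd (charpoly_monic M).ne_zero hdvd)⟩
end

section
/- Let V be a finite type, M : Matrix V V ℂ, and φ any permutation of V such that M (φ i) (φ j) = M i j for all i, j. Let M_φ be the divisor matrix of M associated with φ. Then there exist a natural number m with card V = card O + m, a matrix B : Matrix (Fin m) (Fin m) ℂ, an equivalence e : V ≃ O ⊕ Fin m, and an invertible matrix T : Matrix V V ℂ, such that T⁻¹ * M * T equals the transport along e of the block matrix with top-left block M_φ, bottom-right block B, and zero off-diagonal blocks. Consequently the characteristic polynomial of M_φ divides the characteristic polynomial of M in ℂ[X], so every eigenvalue of M_φ is an eigenvalue of M with at least the same multiplicity. -/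
open Matrix Polynomial

/-- If `C` intertwines `A` with `M`, `D` intertwines `M` with `N`, and `D * C` is invertible, then
`M` is similar to a block diagonal matrix with blocks `A` and the action of `M` on `ker D`. -/
theorem Matrix.exists_similar_fromBlocks_of_intertwine {K V O : Type*} [Field K]
    [Fintype V] [DecidableEq V] [Fintype O] [DecidableEq O]
    {M : Matrix V V K} {A N : Matrix O O K} {C : Matrix V O K} {D : Matrix O V K}
    (hC : M * C = C * A) (hD : D * M = N * D) (hDC : IsUnit (D * C)) :
    ∃ (m : ℕ) (B : Matrix (Fin m) (Fin m) K) (e : V ≃ O ⊕ Fin m) (T : Matrix V V K),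
      Fintype.card V = Fintype.card O + m ∧ IsUnit T ∧
      T⁻¹ * M * T = Matrix.reindex e.symm e.symm (Matrix.fromBlocks A 0 0 B) := by
  set W := LinearMap.ker D.mulVecLin
  let b := Module.finBasis K W
  have hsurj : LinearMap.range D.mulVecLin = ⊤ := by
    rw [LinearMap.range_eq_top]
    intro y
    obtain ⟨x, hx⟩ := Matrix.mulVec_surjective_iff_isUnit.2 hDC y
    exact ⟨C *ᵥ x, by simpa using hx⟩
  have hcard : Fintype.card V = Fintype.card O + Module.finrank K W := by
    have h := LinearMap.finrank_range_add_finrank_ker D.mulVecLin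
    rw [hsurj, finrank_top, Module.finrank_fintype_fun_eq_card,
      Module.finrank_fintype_fun_eq_card] at h
    exact h.symm
  let U : Matrix V (Fin (Module.finrank K W)) K := Matrix.of fun v j => (b j : V → K) v
  have hU : ∀ y, U *ᵥ y = ((∑ j, y j • b j : W) : V → K) := by
    intro y
    ext v
    simp [U, Matrix.mulVec, dotProduct, mul_comm]
  have hDU : ∀ w : W, D *ᵥ (w : V → K) = 0 := fun w => w.2
  have hinv : ∀ w : W, M *ᵥ (w : V → K) ∈ W := by
    intro w
    simp [W, Matrix.mulVec_mulVec, hD, ← Matrix.mulVec_mulVec _ N D, hDU w]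
  let B : Matrix (Fin (Module.finrank K W)) (Fin (Module.finrank K W)) K :=
    Matrix.of fun i j => b.repr ⟨M *ᵥ (b j : V → K), hinv (b j)⟩ i
  have hB : M * U = U * B := by
    ext v j
    have h := hU (B.col j)
    simp only [B, Matrix.col_apply, Matrix.of_apply, b.sum_repr] at h
    exact (congrFun h v).symm
  have hQ : ∀ z : O ⊕ Fin (Module.finrank K W) → K, Matrix.fromCols C U *ᵥ z = 0 → z = 0 := by
    intro z hz
    rw [Matrix.fromCols_mulVec] at hz
    have h₁ : z ∘ Sum.inl = 0 := by
      apply Matrix.mulVec_injective_of_isUnit hDC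
      have h := congrArg (D *ᵥ ·) hz
      rw [hU] at h
      simpa only [Matrix.mulVec_add, hDU, Matrix.mulVec_mulVec, add_zero, Matrix.mulVec_zero]
        using h
    have h₂ : ∑ j, (z ∘ Sum.inr) j • b j = 0 := by
      rw [h₁, Matrix.mulVec_zero, zero_add, hU] at hz
      exact Subtype.ext hz
    have h₃ := Fintype.linearIndependent_iff.1 b.linearIndependent _ h₂
    ext (i | j)
    · exact congrFun h₁ i
    · exact h₃ j
  let e : V ≃ O ⊕ Fin (Module.finrank K W) := Fintype.equivOfCardEq (by simpa using hcard)
  have hT : IsUnit ((Matrix.fromCols C U).submatrix id e) := by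
    rw [← Matrix.mulVec_injective_iff_isUnit]
    refine (injective_iff_map_eq_zero
      ((Matrix.fromCols C U).submatrix id e).mulVecLin).2 fun x hx => ?_
    have h := hQ (x ∘ e.symm) (by simpa [Matrix.submatrix_mulVec_equiv] using hx)
    ext v
    simpa using congrFun h (e v)
  refine ⟨_, B, e, _, hcard, hT, ?_⟩
  have hMQ : M * Matrix.fromCols C U = Matrix.fromCols C U * Matrix.fromBlocks A 0 0 B := by
    rw [Matrix.mul_fromCols, Matrix.fromCols_mul_fromBlocks, hC, hB]
    simp
  have hMT : M * (Matrix.fromCols C U).submatrix id e =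
      (Matrix.fromCols C U).submatrix id e *
        Matrix.reindex e.symm e.symm (Matrix.fromBlocks A 0 0 B) := by
    rw [Matrix.reindex_apply, Equiv.symm_symm, Matrix.submatrix_mul_equiv, ← hMQ]
    rfl
  rw [Matrix.mul_assoc, hMT,
    Matrix.nonsing_inv_mul_cancel_left _ _ ((Matrix.isUnit_iff_isUnit_det _).1 hT)]

/-- The indicator matrix of the fibres of `orb` intertwines the divisor matrix with `M`. -/
theorem Matrix.mul_indicator_eq_indicator_mul_divisor {K V O : Type*} [Field K]
    [Fintype V] [Fintype O] [DecidableEq O]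
    {M : Matrix V V K} {φ : Equiv.Perm V} (hM : ∀ i j, M (φ i) (φ j) = M i j)
    {orb : V → O} {s : O → V}
    (horb : ∀ u v : V, orb u = orb v ↔ ∃ k : ℕ, v = (φ ^ k) u) (hs : ∀ o, orb (s o) = o) :
    M * Matrix.of (fun v o => if orb v = o then (1 : K) else 0) =
      Matrix.of (fun v o => if orb v = o then (1 : K) else 0) *
        Matrix.of fun o o' => ∑ v ∈ Finset.univ.filter (fun v => orb v = o'), M (s o) v := by
  ext v o
  obtain ⟨k, hk⟩ := (horb (s (orb v)) v).1 (hs _)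
  have hMk : ∀ i j, M ((φ ^ k) i) ((φ ^ k) j) = M i j := by
    clear hk
    induction k with
    | zero => simp
    | succ k ih => intro i j; simp [pow_succ, ih, hM]
  have horbk : ∀ w, orb ((φ ^ k) w) = orb w := fun w => ((horb _ _).2 ⟨k, rfl⟩).symm
  simp only [Matrix.mul_apply, Matrix.of_apply, mul_ite, mul_one, mul_zero, ite_mul, one_mul,
    zero_mul, Finset.sum_ite_eq, Finset.mem_univ, if_true, Finset.sum_filter]
  rw [← Equiv.sum_comp (φ ^ k)]
  refine Finset.sum_congr rfl fun w _ => ?_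
  rw [horbk]
  nth_rewrite 1 [hk]
  rw [hMk]

theorem general_equitable_decomposition
    (V : Type*) [Fintype V] [DecidableEq V]
    (M : Matrix V V ℂ) (φ : Equiv.Perm V)
    (hM : ∀ i j, M (φ i) (φ j) = M i j)
    (O : Type*) [Fintype O] [DecidableEq O]
    (orb : V → O) (s : O → V)
    (horb : ∀ u v : V, orb u = orb v ↔ ∃ k : ℕ, v = (φ ^ k) u)
    (hs : ∀ o, orb (s o) = o)
    (Mφ : Matrix O O ℂ)
    (hMφ : ∀ o o', Mφ o o' = ∑ v ∈ Finset.univ.filter (fun v => orb v = o'), M (s o) v) :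
    (∃ (m : ℕ) (B : Matrix (Fin m) (Fin m) ℂ) (e : V ≃ O ⊕ Fin m) (T : Matrix V V ℂ),
      Fintype.card V = Fintype.card O + m ∧ IsUnit T ∧
      T⁻¹ * M * T = Matrix.reindex e.symm e.symm (Matrix.fromBlocks Mφ 0 0 B)) ∧
    Mφ.charpoly ∣ M.charpoly ∧
    ∀ z : ℂ, Multiset.count z Mφ.charpoly.roots ≤ Multiset.count z M.charpoly.roots := by
  let C : Matrix V O ℂ := Matrix.of fun v o => if orb v = o then 1 else 0
  have hC : M * C = C * Mφ := by
    rw [show Mφ = Matrix.of _ from Matrix.ext hMφ]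
    exact Matrix.mul_indicator_eq_indicator_mul_divisor hM horb hs
  have hD := congrArg Matrix.transpose (Matrix.mul_indicator_eq_indicator_mul_divisor
    (M := Mᵀ) (fun i j => hM j i) horb hs)
  rw [Matrix.transpose_mul, Matrix.transpose_mul, Matrix.transpose_transpose] at hD
  have hDC : IsUnit (Cᵀ * C) := by
    have h : Cᵀ * C = Matrix.diagonal
        fun o => ((Finset.univ.filter fun v => orb v = o).card : ℂ) := by
      ext o o'
      by_cases ho : o = o'
      · subst ho
        simp [C, Matrix.mul_apply, ← ite_and]
      · rw [Matrix.diagonal_apply_ne _ ho, Matrix.mul_apply]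
        refine Finset.sum_eq_zero fun v _ => ?_
        by_cases hv : orb v = o
        · have : orb v ≠ o' := fun h' => ho (hv.symm.trans h')
          simp [C, this]
        · simp [C, hv]
    rw [h, Matrix.isUnit_diagonal, Pi.isUnit_iff]
    intro o
    rw [isUnit_iff_ne_zero, Nat.cast_ne_zero, Finset.card_ne_zero]
    exact ⟨s o, by simp [hs]⟩
  have hmain := Matrix.exists_similar_fromBlocks_of_intertwine hC hD hDC
  have hdvd : Mφ.charpoly ∣ M.charpoly := by
    obtain ⟨m, B, e, T, -, hT, h⟩ := hmain
    obtain ⟨T, rfl⟩ := hT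
    have hchar := congrArg Matrix.charpoly h
    rw [Matrix.charpoly_units_conj', Matrix.charpoly_reindex,
      Matrix.charpoly_fromBlocks_zero₁₂] at hchar
    exact ⟨_, hchar⟩
  exact ⟨hmain, hdvd, fun z =>
    Multiset.le_iff_count.1 (Polynomial.roots.le_of_dvd M.charpoly_monic.ne_zero hdvd) z⟩
end

section
/- Let V be a finite type and φ a permutation of V whose order is p^N · ℓ, where p is a prime not dividing ℓ and N ≥ 1. Then for every matrix M : Matrix V V ℂ and every a, b ∈ V: Σ over r in the orbit of b under φ^{p^N} of (Σ over s in the orbit of r under φ^ℓ of M a s) = Σ over t in the orbit of b under φ of M a t. In particular, the orbit of b under φ is the disjoint union, over r in the orbit of b under φ^{p^N}, of the orbits of r under φ^ℓ. -/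
open Matrix

/-- The orbit of `b` under the permutation `ψ`, i.e. the finite set `{ψ^k b : k ≥ 0}`.
Since `ψ ^ orderOf ψ = 1`, this set is exhausted by exponents `k < orderOf ψ`. -/
noncomputable def permOrbit {V : Type*} [Fintype V] [DecidableEq V] (ψ : Equiv.Perm V) (b : V) :
    Finset V :=
  Finset.image (fun k => (ψ ^ k) b) (Finset.range (orderOf ψ))

theorem mem_permOrbit {V : Type*} [Fintype V] [DecidableEq V] {ψ : Equiv.Perm V} {b x : V} :
    x ∈ permOrbit ψ b ↔ ψ.SameCycle b x := by
  simp only [permOrbit, Finset.mem_image, Finset.mem_range]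
  constructor
  · rintro ⟨k, -, rfl⟩
    exact ⟨k, by simp⟩
  · intro h
    obtain ⟨k, rfl⟩ := h.exists_nat_pow_eq
    exact ⟨k % orderOf ψ, Nat.mod_lt _ (orderOf_pos ψ), by simp only [pow_mod_orderOf]⟩

/-- If `φ ^ (m * ℓ) = 1` with `m` and `ℓ` coprime, then a cycle of `φ ^ m` and a cycle of `φ ^ ℓ`
share at most one point. -/
theorem Equiv.Perm.SameCycle.eq_of_coprime_pow {V : Type*} {φ : Equiv.Perm V} {m ℓ : ℕ}
    (hc : m.Coprime ℓ) (hφ : φ ^ (m * ℓ) = 1) {x y : V}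
    (hm : (φ ^ m).SameCycle x y) (hℓ : (φ ^ ℓ).SameCycle x y) : x = y := by
  obtain ⟨j, rfl⟩ := hm
  obtain ⟨k, hk⟩ := hℓ
  obtain ⟨u, v, huv⟩ := Nat.isCoprime_iff_coprime.mpr hc
  have hφ' (n : ℤ) : φ ^ ((m * ℓ : ℤ) * n) = 1 := by
    rw [_root_.zpow_mul, ← Nat.cast_mul, zpow_natCast, hφ, _root_.one_zpow]
  have hfix : (φ ^ ((m : ℤ) * j - ℓ * k)) x = x := by
    rw [← neg_add_eq_sub, _root_.zpow_add, Equiv.Perm.mul_apply, _root_.zpow_neg, Equiv.Perm.inv_eq_iff_eq]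
    simpa only [_root_.zpow_mul, zpow_natCast] using hk.symm
  have hexp : (m : ℤ) * j =
      ((m : ℤ) * j - ℓ * k) * (u * m) + (m * ℓ) * (v * j + k * u) := by
    linear_combination -(m : ℤ) * j * huv
  have hmj : (φ ^ ((m : ℤ) * j)) x = x := by
    rw [hexp, _root_.zpow_add, hφ', mul_one, _root_.zpow_mul]
    exact Equiv.Perm.zpow_apply_eq_self_of_apply_eq_self hfix _
  simpa only [_root_.zpow_mul, zpow_natCast] using hmj.symm

theorem pairwiseDisjoint_permOrbit_pow {V : Type*} [Fintype V] [DecidableEq V]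
    {φ : Equiv.Perm V} {m ℓ : ℕ} (hc : m.Coprime ℓ) (hφ : φ ^ (m * ℓ) = 1) (b : V) :
    (permOrbit (φ ^ m) b : Set V).PairwiseDisjoint (permOrbit (φ ^ ℓ)) := by
  intro x hx y hy hxy
  refine Finset.disjoint_left.mpr fun z hzx hzy => hxy ?_
  rw [Finset.mem_coe, mem_permOrbit] at hx hy
  rw [mem_permOrbit] at hzx hzy
  exact (hx.symm.trans hy).eq_of_coprime_pow hc hφ (hzx.trans hzy.symm)

theorem biUnion_permOrbit_pow {V : Type*} [Fintype V] [DecidableEq V]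
    (φ : Equiv.Perm V) {m ℓ : ℕ} (hc : m.Coprime ℓ) (b : V) :
    (permOrbit (φ ^ m) b).biUnion (permOrbit (φ ^ ℓ)) = permOrbit φ b := by
  ext y
  simp only [Finset.mem_biUnion, mem_permOrbit]
  constructor
  · rintro ⟨x, hx, hy⟩
    exact hx.of_pow.trans hy.of_pow
  · rintro ⟨i, rfl⟩
    obtain ⟨u, v, huv⟩ := Nat.isCoprime_iff_coprime.mpr hc
    refine ⟨((φ ^ m) ^ (u * i)) b, ⟨u * i, rfl⟩, v * i, ?_⟩
    rw [← Equiv.Perm.mul_apply, ← zpow_natCast, ← zpow_natCast, ← _root_.zpow_mul, ← _root_.zpow_mul,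
      ← _root_.zpow_add]
    congr 2
    linear_combination i * huv

theorem orbit_sum_decomposition
    (V : Type*) [Fintype V] [DecidableEq V]
    (φ : Equiv.Perm V) (p N ℓ : ℕ) (hp : p.Prime) (hN : 1 ≤ N)
    (hpl : ¬ p ∣ ℓ) (hord : orderOf φ = p ^ N * ℓ)
    (M : Matrix V V ℂ) (a b : V) :
    ∑ x ∈ permOrbit (φ ^ (p ^ N)) b, ∑ y ∈ permOrbit (φ ^ ℓ) x, M a y
      = ∑ t ∈ permOrbit φ b, M a t := by
  have hc : (p ^ N).Coprime ℓ := ((hp.coprime_iff_not_dvd).mpr hpl).pow_left N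
  have hφ : φ ^ (p ^ N * ℓ) = 1 := hord ▸ pow_orderOf_eq_one φ
  rw [← biUnion_permOrbit_pow φ hc b, Finset.sum_biUnion (pairwiseDisjoint_permOrbit_pow hc hφ b)]
end
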